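/- Let n ≥ 3, let 1 ≤ k ≤ n−2, let U ⊆ ℝⁿ be open, and let σ be a smooth map from U to k-forms satisfying the flat conformal Killing equation. Define the exterior-derivative-type (k+1)-form (dσ)(x)(a₁,…,a_{k+1}) := Σ_{i=1}^{k+1} (−1)^{i+1} (Dσ(x)aᵢ)(a₁,…,âᵢ,…,a_{k+1}). Then dσ is a dual-Killing (k+1)-form: there exists a smooth map τ′ from U to k-forms such that for all x ∈ U and all c, a₁, …, a_{k+1} ∈ ℝⁿ, (D(dσ)(x)c)(a₁,…,a_{k+1}) = Σ_{i=1}^{k+1} (−1)^{i+1} ⟨c,aᵢ⟩ τ′(x)(a₁,…,âᵢ,…,a_{k+1}). In particular dσ satisfies the flat conformal Killing equation for (k+1)-forms and is closed. (This is the Euclidean instance, with Einstein scale α ≡ 1 and vanishing Weyl curvature, of the helicity-raising theorem on almost Einstein manifolds.) -/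

import Mathlib

open scoped RealInnerProductSpace BigOperators

noncomputable section

/-- Euclidean `n`-space. -/
abbrev Euc (n : ℕ) : Type := EuclideanSpace ℝ (Fin n)

/-- Continuous `k`-linear maps `(ℝⁿ)ᵏ → ℝ`. -/
abbrev FormML (n k : ℕ) : Type :=
  ContinuousMultilinearMap ℝ (fun _ : Fin k => Euc n) ℝ

/-- A multilinear map is alternating (vanishes when two arguments coincide);
together with multilinearity this makes it a `k`-form. -/
def IsAlt {n k : ℕ} (f : FormML n k) : Prop :=
  ∀ (v : Fin k → Euc n) (i j : Fin k), i ≠ j → v i = v j → f v = 0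

/-- The tuple `a` with its `i`-th entry omitted. -/
def omitArg {X : Type*} {k : ℕ} (i : Fin k) (a : Fin k → X) (j : Fin (k - 1)) : X :=
  if (j : ℕ) < (i : ℕ) then a ⟨j, by have := j.isLt; have := i.isLt; omega⟩
  else a ⟨(j : ℕ) + 1, by have := j.isLt; omega⟩

/-- The tuple `(c, d₁, …, d_{k-1})`. -/
def consCast {X : Type*} {k : ℕ} (c : X) (d : Fin (k - 1) → X) (j : Fin k) : X :=
  if h : (j : ℕ) = 0 then c else d ⟨(j : ℕ) - 1, by have := j.isLt; omega⟩

/-- The flat (Euclidean) conformal Killing equation on `k`-forms: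
`σ` is smooth on `U`, valued in alternating maps, and there are smooth form-valued
`τ` (degree `k-1`) and `ρ` (degree `k+1`) with
`(Dσ(x)c)(a₁,…,a_k) = Σᵢ (-1)^(i+1) ⟨c,aᵢ⟩ τ(x)(a₁,…,âᵢ,…,a_k) + ρ(x)(c,a₁,…,a_k)`. -/
def FlatCKF (n k : ℕ) (U : Set (Euc n)) (σ : Euc n → FormML n k) : Prop :=
  ContDiffOn ℝ (⊤ : ℕ∞) σ U ∧ (∀ x ∈ U, IsAlt (σ x)) ∧
  ∃ (τ : Euc n → FormML n (k - 1)) (ρ : Euc n → FormML n (k + 1)),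
    ContDiffOn ℝ (⊤ : ℕ∞) τ U ∧ ContDiffOn ℝ (⊤ : ℕ∞) ρ U ∧
    (∀ x ∈ U, IsAlt (τ x)) ∧ (∀ x ∈ U, IsAlt (ρ x)) ∧
    ∀ x ∈ U, ∀ (c : Euc n) (a : Fin k → Euc n),
      (fderiv ℝ σ x c) a =
        (∑ i : Fin k, (-1 : ℝ) ^ (i : ℕ) * ⟪c, a i⟫ * τ x (omitArg i a))
        + ρ x (consCast c a)

section HelicityRaising

open AlternatingMap

variable {V : Type*} [NormedAddCommGroup V] [InnerProductSpace ℝ V] {m : ℕ}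

/-- The map `(c, d) ↦ ⟪c, d⟫ • T`. -/
def innerSMul (T : V [⋀^Fin m]→ₗ[ℝ] ℝ) : V →ₗ[ℝ] V →ₗ[ℝ] V [⋀^Fin m]→ₗ[ℝ] ℝ :=
  LinearMap.smulRightₗ.flip T ∘ₗ innerₗ V

/-- The wedge product `c♭ ∧ T` of the covector dual to `c` with `T`, as a linear map in `c`. -/
def flatWedge (T : V [⋀^Fin m]→ₗ[ℝ] ℝ) : V →ₗ[ℝ] V [⋀^Fin (m + 1)]→ₗ[ℝ] ℝ :=
  alternatizeUncurryFinLM ∘ₗ innerSMul T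

theorem flatWedge_apply (T : V [⋀^Fin m]→ₗ[ℝ] ℝ) (c : V) (a : Fin (m + 1) → V) :
    flatWedge T c a = ∑ i : Fin (m + 1), (-1 : ℝ) ^ (i : ℕ) * ⟪c, a i⟫ * T (i.removeNth a) := by
  simp [flatWedge, innerSMul, alternatizeUncurryFin_apply, mul_assoc, zsmul_eq_mul]

theorem alternatizeUncurryFin_flatWedge (T : V [⋀^Fin m]→ₗ[ℝ] ℝ) :
    alternatizeUncurryFin (flatWedge T) = 0 :=
  alternatizeUncurryFin_alternatizeUncurryFinLM_comp_of_symmetric fun x y => by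
    ext v
    simp [innerSMul, real_inner_comm]

theorem flatWedge_eq_zero (T : V [⋀^Fin m]→ₗ[ℝ] ℝ) {c : V} {a : Fin (m + 1) → V}
    (h : ∀ i, ⟪c, a i⟫ = 0) : flatWedge T c a = 0 := by
  simp [flatWedge_apply, h]

theorem flatWedge_eq_single (T : V [⋀^Fin m]→ₗ[ℝ] ℝ) {c : V} {a : Fin (m + 1) → V}
    (p : Fin (m + 1)) (h : ∀ i, i ≠ p → ⟪c, a i⟫ = 0) :
    flatWedge T c a = (-1 : ℝ) ^ (p : ℕ) * ⟪c, a p⟫ * T (p.removeNth a) := by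
  rw [flatWedge_apply]
  exact Fintype.sum_eq_single p fun i hi => by simp [h i hi]

theorem AlternatingMap.finsetSum_apply {ι : Type*} (s : Finset ι)
    (f : ι → V [⋀^Fin m]→ₗ[ℝ] ℝ) (v : Fin m → V) : (∑ i ∈ s, f i) v = ∑ i ∈ s, f i v := by
  induction s using Finset.cons_induction with
  | empty => simp
  | cons i s hi ih => simp [Finset.sum_cons, ih]

theorem AlternatingMap.map_cons_cons_swap (f : V [⋀^Fin (m + 2)]→ₗ[ℝ] ℝ) (x y : V)
    (w : Fin m → V) :
    f (Fin.cons x (Fin.cons y w : Fin (m + 1) → V)) =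
      -f (Fin.cons y (Fin.cons x w : Fin (m + 1) → V)) := by
  have h := f.map_swap (Fin.cons y (Fin.cons x w : Fin (m + 1) → V))
    (show (0 : Fin (m + 2)) ≠ 1 by simp)
  rw [← h]
  congr 1
  ext i
  refine Fin.cases ?_ (fun i => Fin.cases ?_ (fun i => ?_) i) i
  · simp
  · simp
  · have h0 : i.succ.succ ≠ (0 : Fin (m + 2)) := Fin.succ_ne_zero _
    have h1 : i.succ.succ ≠ (1 : Fin (m + 2)) := by
      simp [Fin.ext_iff]
    simp [Equiv.swap_apply_of_ne_of_ne h0 h1]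

section Symmetry

variable {ι : Type*} [Fintype ι] (e : OrthonormalBasis ι ℝ V)
  {R : V →ₗ[ℝ] V [⋀^Fin (m + 2)]→ₗ[ℝ] ℝ} {T : V → V [⋀^Fin m]→ₗ[ℝ] ℝ}
  (h : ∀ (c d : V) (a : Fin (m + 1) → V),
    flatWedge (T d) c a + R d (Fin.cons c a) = flatWedge (T c) d a + R c (Fin.cons d a))

include h

theorem apply_cons_comm_of_notMem {c d : ι} {v : Fin (m + 1) → ι}
    (hc : ∀ i, c ≠ v i) (hd : ∀ i, d ≠ v i) :
    R (e d) (Fin.cons (e c) fun i => e (v i)) = R (e c) (Fin.cons (e d) fun i => e (v i)) := by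
  have := h (e c) (e d) fun i => e (v i)
  rwa [flatWedge_eq_zero _ fun i => e.inner_eq_zero (hc i),
    flatWedge_eq_zero _ fun i => e.inner_eq_zero (hd i), zero_add, zero_add] at this

theorem apply_eq_zero_of_notMem {d : ι} {b : Fin (m + 2) → ι}
    (hb : Function.Injective b) (hd : ∀ i, d ≠ b i) : R (e d) (fun i => e (b i)) = 0 := by
  obtain ⟨p, b, rfl⟩ : ∃ p b', b = Fin.cons p b' := ⟨_, _, (Fin.cons_self_tail b).symm⟩
  obtain ⟨q, w, rfl⟩ : ∃ q w, b = Fin.cons q w := ⟨_, _, (Fin.cons_self_tail b).symm⟩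
  rw [Fin.cons_injective_iff, Fin.cons_injective_iff] at hb
  simp only [Fin.forall_fin_succ, Fin.cons_zero, Fin.cons_succ] at hd
  simp only [Set.mem_range, not_exists, Fin.forall_fin_succ, Fin.cons_zero, Fin.cons_succ] at hb
  have comp (x : ι) {j : ℕ} (u : Fin j → ι) :
      (fun i => e ((Fin.cons x u : Fin (j + 1) → ι) i)) = Fin.cons (e x) fun i => e (u i) := by
    ext i : 1
    refine Fin.cases ?_ (fun i => ?_) i <;> simp
  have key (x y z : ι) (hx : x ≠ z) (hy : y ≠ z) (hxw : ∀ i, x ≠ w i) (hyw : ∀ i, y ≠ w i) :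
      R (e y) (Fin.cons (e x) (Fin.cons (e z) fun i => e (w i) : Fin (m + 1) → V)) =
        R (e x) (Fin.cons (e y) (Fin.cons (e z) fun i => e (w i) : Fin (m + 1) → V)) := by
    have := apply_cons_comm_of_notMem e h (c := x) (d := y) (v := Fin.cons z w)
      (by simpa [Fin.forall_fin_succ] using ⟨hx, hxw⟩)
      (by simpa [Fin.forall_fin_succ] using ⟨hy, hyw⟩)
    simpa only [comp] using this
  obtain ⟨⟨hqp, hpw⟩, hqw, -⟩ := hb
  obtain ⟨hdp, hdq, hdw⟩ := hd
  have hpw' i : p ≠ w i := fun h => hpw i h.symm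
  have hqw' i : q ≠ w i := fun h => hqw i h.symm
  simp only [comp]
  have h1 := key p d q (Ne.symm hqp) hdq hpw' hdw
  have h2 := key q d p hqp hdp hqw' hdw
  have h3 := key q p d (Ne.symm hdq) (Ne.symm hdp) hqw' hpw'
  rw [(R (e d)).map_cons_cons_swap] at h2
  rw [(R (e p)).map_cons_cons_swap, (R (e q)).map_cons_cons_swap] at h3
  linarith

theorem apply_cons_self {c d : ι} {w : Fin m → ι} (hcd : c ≠ d) (hc : ∀ i, c ≠ w i)
    (hd : ∀ i, d ≠ w i) :
    R (e c) (Fin.cons (e c) (Fin.cons (e d) fun i => e (w i) : Fin (m + 1) → V)) =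
      -T (e d) fun i => e (w i) := by
  have := h (e c) (e d) (Fin.cons (e c) fun i => e (w i))
  rw [flatWedge_eq_single (T (e d)) 0, flatWedge_eq_zero (T (e c)),
    (R (e d)).map_eq_zero_of_eq _ (i := 0) (j := 1) (by simp) (by simp),
    (R (e c)).map_cons_cons_swap] at this
  · simp at this
    linarith
  · refine Fin.cases ?_ fun i => ?_
    · simpa using e.inner_eq_zero hcd.symm
    · simpa using e.inner_eq_zero (hd i)
  · refine Fin.cases ?_ fun i => ?_
    · simp
    · intro
      simpa using e.inner_eq_zero (hc i)

/-- A tensor `R`, alternating in all but the first argument, that satisfies the integrability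
condition of the conformal Killing equation is `c ↦ c♭ ∧ τ` with `τ` a multiple of its trace. -/
theorem eq_flatWedge_trace (hm : m + 1 < Fintype.card ι) :
    R = flatWedge (((Fintype.card ι : ℝ) - (m + 1))⁻¹ • ∑ j, (R (e j)).curryLeft (e j)) := by
  classical
  refine e.toBasis.ext fun j => e.toBasis.ext_alternating fun b hb => ?_
  simp only [OrthonormalBasis.coe_toBasis]
  by_cases hj : ∀ i, j ≠ b i
  · rw [apply_eq_zero_of_notMem e h hb hj, flatWedge_eq_zero]
    exact fun i => e.inner_eq_zero (hj i)
  push Not at hj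
  obtain ⟨p, rfl⟩ := hj
  rw [flatWedge_eq_single _ p fun i hi => e.inner_eq_zero (hb.ne hi.symm)]
  set a : Fin (m + 1) → ι := p.removeNth b
  have hbp i : b p ≠ a i := hb.ne (Fin.succAbove_ne p i).symm
  have hainj : Function.Injective a := hb.comp Fin.succAbove_right_injective
  have hrem : (p.removeNth fun i => e (b i)) = fun i => e (a i) := rfl
  have hself : R (e (b p)) (fun i => e (b i)) =
      (-1 : ℝ) ^ (p : ℕ) * R (e (b p)) (Fin.cons (e (b p)) fun i => e (a i)) := by
    have := (R (e (b p))).map_insertNth p (e (b p)) (fun i => e (a i))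
    rw [← hrem, Fin.insertNth_self_removeNth p fun i => e (b i)] at this
    rw [this, hrem]
    simp [Matrix.vecCons, zsmul_eq_mul]
  have hval (l : ι) : R (e l) (Fin.cons (e l) fun i => e (a i)) =
      if l ∈ Finset.univ.image a then 0 else
        R (e (b p)) (Fin.cons (e (b p)) fun i => e (a i)) := by
    split_ifs with hl
    · obtain ⟨i, -, rfl⟩ := Finset.mem_image.1 hl
      exact (R _).map_eq_zero_of_eq _ (i := 0) (j := i.succ) (by simp) (Fin.succ_ne_zero i).symm
    · have hl' i : l ≠ a i := fun hi => hl (Finset.mem_image.2 ⟨i, Finset.mem_univ _, hi.symm⟩)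
      have hcons : (fun i => e (a i)) = Fin.cons (e (a 0)) fun i => e (a i.succ) :=
        (Fin.cons_self_tail fun i => e (a i)).symm
      have h0 (i : Fin m) : a 0 ≠ a i.succ := hainj.ne (Fin.succ_ne_zero i).symm
      rw [hcons, apply_cons_self e h (hl' 0) (fun i => hl' _) h0,
        apply_cons_self e h (hbp 0) (fun i => hbp _) h0]
  have hsum : ∑ l, R (e l) (Fin.cons (e l) fun i => e (a i)) =
      ((Fintype.card ι : ℝ) - (m + 1)) *
        R (e (b p)) (Fin.cons (e (b p)) fun i => e (a i)) := by
    rw [Finset.sum_congr rfl fun l _ => hval l, Finset.sum_ite, Finset.sum_const_zero, zero_add, Finset.sum_const, nsmul_eq_mul,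
      Finset.filter_not, Finset.filter_mem_eq_inter, Finset.univ_inter,
      Finset.card_sdiff_of_subset (Finset.subset_univ _), Finset.card_image_of_injective _ hainj,
      Finset.card_univ, Finset.card_univ, Fintype.card_fin, Nat.cast_sub hm.le]
    rw [Nat.cast_add, Nat.cast_one]
  have hne : (Fintype.card ι : ℝ) - (m + 1) ≠ 0 := by
    have : ((m + 1 : ℕ) : ℝ) < Fintype.card ι := by exact_mod_cast hm
    push_cast at this
    linarith
  have htr : (∑ l, (R (e l)).curryLeft (e l)) (fun i => e (a i)) =
      ∑ l, R (e l) (Fin.cons (e l) fun i => e (a i)) := by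
    rw [AlternatingMap.finsetSum_apply]
    rfl
  rw [hself, hrem, AlternatingMap.smul_apply, htr, hsum, smul_eq_mul, inv_mul_cancel_left₀ hne]
  simp

end Symmetry

variable {n k : ℕ}

/-- The alternating map underlying a form. -/
def IsAlt.toAlternatingMap {f : FormML n k} (h : IsAlt f) : Euc n [⋀^Fin k]→ₗ[ℝ] ℝ :=
  { f.toMultilinearMap with
    map_eq_zero_of_eq' := fun v i j hv hij => h v i j hij hv }

@[simp]
theorem IsAlt.toAlternatingMap_apply {f : FormML n k} (h : IsAlt f) (v : Fin k → Euc n) :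
    h.toAlternatingMap v = f v := rfl

theorem omitArg_eq_removeNth {X : Type*} (i : Fin (k + 1)) (a : Fin (k + 1) → X) :
    (omitArg i a : Fin k → X) = i.removeNth a := by
  ext j
  simp only [omitArg, Fin.removeNth_apply, Fin.succAbove, Fin.lt_def, Fin.val_castSucc]
  split_ifs <;> rfl

theorem consCast_eq_cons {X : Type*} (c : X) (a : Fin k → X) :
    (consCast c a : Fin (k + 1) → X) = Fin.cons c a := by
  ext j
  refine Fin.cases ?_ (fun j => ?_) j <;> simp [consCast]

theorem fderiv_form_apply {f : Euc n → FormML n k} {x : Euc n} (hf : DifferentiableAt ℝ f x)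
    (v : Fin k → Euc n) (c : Euc n) : fderiv ℝ (fun y => f y v) x c = fderiv ℝ f x c v := by
  have := ((ContinuousMultilinearMap.apply ℝ (fun _ : Fin k => Euc n) ℝ v).hasFDerivAt.comp x
    hf.hasFDerivAt).fderiv
  exact congrArg (fun L : Euc n →L[ℝ] ℝ => L c) this

theorem differentiableAt_form_apply {f : Euc n → FormML n k} {x : Euc n}
    (hf : DifferentiableAt ℝ f x) (v : Fin k → Euc n) :
    DifferentiableAt ℝ (fun y => f y v) x :=
  (ContinuousMultilinearMap.apply ℝ (fun _ : Fin k => Euc n) ℝ v).differentiableAt.comp x hf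

theorem isAlt_fderiv {f : Euc n → FormML n k} {U : Set (Euc n)} (hU : IsOpen U)
    (hf : ∀ y ∈ U, IsAlt (f y)) {x : Euc n} (hx : x ∈ U) (hd : DifferentiableAt ℝ f x)
    (c : Euc n) : IsAlt (fderiv ℝ f x c) := by
  intro v i j hij hv
  have h0 : (fun y => f y v) =ᶠ[nhds x] fun _ => (0 : ℝ) := by
    filter_upwards [hU.mem_nhds hx] with y hy using hf y hy v i j hij hv
  rw [← fderiv_form_apply hd, h0.fderiv_eq]
  simp

/-- The derivative of a field of forms, as a linear map into alternating maps. -/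
def fderivAlt {f : Euc n → FormML n k} {x : Euc n} (h : ∀ c, IsAlt (fderiv ℝ f x c)) :
    Euc n →ₗ[ℝ] Euc n [⋀^Fin k]→ₗ[ℝ] ℝ where
  toFun c := (h c).toAlternatingMap
  map_add' c d := by ext v; simp
  map_smul' r c := by ext v; simp

@[simp]
theorem fderivAlt_apply {f : Euc n → FormML n k} {x : Euc n} (h : ∀ c, IsAlt (fderiv ℝ f x c))
    (c : Euc n) (v : Fin k → Euc n) : fderivAlt h c v = fderiv ℝ f x c v := rfl

end HelicityRaising

/-- Euclidean helicity raising. If `σ` is a flat conformal Killing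
`k`-form (`1 ≤ k ≤ n-2`) then the exterior-derivative-type `(k+1)`-form
`(dσ)(x)(a₁,…,a_{k+1}) = Σᵢ (-1)^{i+1} (Dσ(x)aᵢ)(a₁,…,âᵢ,…,a_{k+1})` is a
dual-Killing `(k+1)`-form. -/
theorem flat_conformal_killing_differential_is_dual_Killing
    (n k : ℕ) (hn : 3 ≤ n) (hk1 : 1 ≤ k) (hkn : k ≤ n - 2)
    (U : Set (Euc n)) (hU : IsOpen U)
    (σ : Euc n → FormML n k) (hσ : FlatCKF n k U σ) :
    ∃ τ' : Euc n → FormML n k,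
      ContDiffOn ℝ (⊤ : ℕ∞) τ' U ∧ (∀ x ∈ U, IsAlt (τ' x)) ∧
      ∀ x ∈ U, ∀ (c : Euc n) (b : Fin (k + 1) → Euc n),
        fderiv ℝ
          (fun y => ∑ i : Fin (k + 1),
            (-1 : ℝ) ^ (i : ℕ) * (fderiv ℝ σ y (b i)) (omitArg i b)) x c
        = ∑ i : Fin (k + 1), (-1 : ℝ) ^ (i : ℕ) * ⟪c, b i⟫ * τ' x (omitArg i b) := by
  obtain ⟨m, rfl⟩ : ∃ m, k = m + 1 := ⟨k - 1, by omega⟩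
  obtain ⟨hσs, -, (τ : Euc n → FormML n m), (ρ : Euc n → FormML n (m + 2)), hτs, hρs, hτa, hρa, heq⟩ := hσ
  simp only [omitArg_eq_removeNth, consCast_eq_cons] at heq ⊢
  let e := EuclideanSpace.basisFun (Fin n) ℝ
  have hτd : ∀ x ∈ U, DifferentiableAt ℝ τ x := fun x hx =>
    (hτs.contDiffAt (hU.mem_nhds hx)).differentiableAt (by simp)
  have hρd : ∀ x ∈ U, DifferentiableAt ℝ ρ x := fun x hx =>
    (hρs.contDiffAt (hU.mem_nhds hx)).differentiableAt (by simp)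
  have hρalt : ∀ x ∈ U, ∀ c, IsAlt (fderiv ℝ ρ x c) := fun x hx =>
    isAlt_fderiv hU hρa hx (hρd x hx)
  have hτalt : ∀ x ∈ U, ∀ c, IsAlt (fderiv ℝ τ x c) := fun x hx =>
    isAlt_fderiv hU hτa hx (hτd x hx)
  have hdσ : ∀ x ∈ U, ∀ b : Fin (m + 2) → Euc n,
      ∑ i : Fin (m + 2), (-1 : ℝ) ^ (i : ℕ) * (fderiv ℝ σ x (b i)) (i.removeNth b) =
        ((m : ℝ) + 2) * ρ x b := by
    intro x hx b
    have h1 := congrArg (fun f => f b) (AlternatingMap.alternatizeUncurryFin_add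
      (flatWedge (hτa x hx).toAlternatingMap) (hρa x hx).toAlternatingMap.curryLeft)
    rw [alternatizeUncurryFin_flatWedge, AlternatingMap.alternatizeUncurryFin_curryLeft,
      zero_add] at h1
    simp only [AlternatingMap.alternatizeUncurryFin_apply, LinearMap.add_apply,
      AlternatingMap.add_apply, flatWedge_apply, AlternatingMap.curryLeft_apply_apply,
      AlternatingMap.smul_apply, IsAlt.toAlternatingMap_apply] at h1
    simp only [heq x hx]
    convert h1 using 1
    · simp only [zsmul_eq_mul, Matrix.vecCons]
      push_cast
      rfl
    · simp only [nsmul_eq_mul]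
      push_cast
      ring
  have hsymm : ∀ x (hx : x ∈ U) (c d : Euc n) (a : Fin (m + 1) → Euc n),
      flatWedge (fderivAlt (hτalt x hx) d) c a + fderivAlt (hρalt x hx) d (Fin.cons c a) =
        flatWedge (fderivAlt (hτalt x hx) c) d a + fderivAlt (hρalt x hx) c (Fin.cons d a) := by
    intro x hx
    have h2 : (2 : WithTop ℕ∞) ≤ ((⊤ : ℕ∞) : WithTop ℕ∞) := by
      change ((2 : ℕ∞) : WithTop ℕ∞) ≤ _
      exact WithTop.coe_le_coe.2 le_top
    have hσx := hσs.contDiffAt (hU.mem_nhds hx)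
    have hdiff : DifferentiableAt ℝ (fderiv ℝ σ) x :=
      (hσx.fderiv_right (m := 1) (by rwa [one_add_one_eq_two])).differentiableAt (by simp)
    have hsnd : ∀ (c d : Euc n) (a : Fin (m + 1) → Euc n),
        flatWedge (fderivAlt (hτalt x hx) d) c a + fderivAlt (hρalt x hx) d (Fin.cons c a) =
          fderiv ℝ (fderiv ℝ σ) x d c a := by
      intro c d a
      have hL : HasFDerivAt (fun y => fderiv ℝ σ y c)
          ((fderiv ℝ (fderiv ℝ σ) x).flip c) x := by
        simpa using hdiff.hasFDerivAt.clm_apply (hasFDerivAt_const c x)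
      have h1 := fderiv_form_apply hL.differentiableAt a d
      rw [hL.fderiv, ContinuousLinearMap.flip_apply] at h1
      have heqx : (fun y => fderiv ℝ σ y c a) =ᶠ[nhds x] fun y =>
          (∑ i : Fin (m + 1), (-1 : ℝ) ^ (i : ℕ) * ⟪c, a i⟫ * τ y (i.removeNth a))
            + ρ y (Fin.cons c a) := by
        filter_upwards [hU.mem_nhds hx] with y hy using heq y hy c a
      have hτv (v : Fin m → Euc n) : DifferentiableAt ℝ (fun y => τ y v) x :=
        differentiableAt_form_apply (hτd x hx) v
      rw [← h1, heqx.fderiv_eq, fderiv_fun_add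
        (DifferentiableAt.fun_sum fun i _ => (hτv _).const_mul _)
        (differentiableAt_form_apply (hρd x hx) _),
        fderiv_fun_sum fun i _ => (hτv _).const_mul _]
      simp only [_root_.add_apply, _root_.sum_apply,
        fderiv_const_mul (hτv _), _root_.smul_apply,
        fderiv_form_apply (hτd x hx), fderiv_form_apply (hρd x hx), flatWedge_apply,
        fderivAlt_apply, smul_eq_mul]
    intro c d a
    rw [hsnd, hsnd, (hσx.isSymmSndFDerivAt (by simpa using h2)).eq]
  refine ⟨fun x => ((m : ℝ) + 2) • ((n : ℝ) - (m + 1))⁻¹ •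
    ∑ j, (fderiv ℝ ρ x (e j)).curryLeft (e j), ?_, ?_, ?_⟩
  · have hρ' : ContDiffOn ℝ (⊤ : ℕ∞) (fderiv ℝ ρ) U := hρs.fderiv_of_isOpen hU (by simp)
    refine (ContDiffOn.sum fun j _ => ?_).const_smul _ |>.const_smul _
    exact (((continuousMultilinearCurryLeftEquiv ℝ (fun _ : Fin (m + 2) => Euc n)
      ℝ).contDiff.comp_contDiffOn (hρ'.clm_apply contDiffOn_const)).clm_apply contDiffOn_const)
  · intro x hx v i j hij hv
    have h0 (l : Fin n) : fderiv ℝ ρ x (e l) (Fin.cons (e l) v) = 0 :=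
      hρalt x hx (e l) _ i.succ j.succ (by simpa using hij) (by simpa using hv)
    simp [h0]
  · intro x hx c b
    have hloc : (fun y => ∑ i : Fin (m + 2),
        (-1 : ℝ) ^ (i : ℕ) * (fderiv ℝ σ y (b i)) (i.removeNth b)) =ᶠ[nhds x]
          fun y => ((m : ℝ) + 2) * ρ y b := by
      filter_upwards [hU.mem_nhds hx] with y hy using hdσ y hy b
    rw [hloc.fderiv_eq, fderiv_const_mul (differentiableAt_form_apply (hρd x hx) b),
      _root_.smul_apply, fderiv_form_apply (hρd x hx), smul_eq_mul]
    have hR := eq_flatWedge_trace e (hsymm x hx) (by simp; omega)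
    have hRc := congrArg (fun L => L c b) hR
    simp only [fderivAlt_apply, flatWedge_apply, Fintype.card_fin] at hRc
    rw [hRc, Finset.mul_sum]
    refine Finset.sum_congr rfl fun i _ => ?_
    simp [AlternatingMap.finsetSum_apply, Matrix.vecCons]
    ring
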